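/- Let h : ℝ → ℝ be a real-valued Schwartz function with derivative h', and a, b, t₀, ξ ∈ ℝ. Let x₀(s) := exp(2πi(a·s²/2 + b·s)). Define V_x^{(g)}(t, ξ) := ∫_ℝ x(s)·g(s − t)·exp(−2πi ξ s) ds and W_h(τ, η) := ∫_ℝ h(τ + t/2)·conj(h(τ − t/2))·exp(−2πi η t) dt. Then −Im( V_{x₀}^{(h')}(t₀, ξ) · conj(V_{x₀}^{(h)}(t₀, ξ)) ) = 2π ∫_ℝ ( a·(τ + t₀) + b − ξ ) · W_h(τ, a·(τ + t₀) + b − ξ) dτ. Consequently, whenever V_{x₀}^{(h)}(t₀, ξ) ≠ 0, the frequency reassignment rule Ω(t₀, ξ) := −Im( V_{x₀}^{(h')}(t₀, ξ) / V_{x₀}^{(h)}(t₀, ξ) ) equals 2π·[ (a·t₀ + b − ξ) + a·(∫_ℝ τ·W_h(τ, a·(τ+t₀)+b−ξ) dτ)/(∫_ℝ W_h(τ, a·(τ+t₀)+b−ξ) dτ) ]. -/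

import Mathlib

open MeasureTheory

/-- The Wigner–Ville distribution of `f : ℝ → ℂ`. -/
noncomputable def WVD (f : ℝ → ℂ) (τ η : ℝ) : ℂ :=
  ∫ t : ℝ, f (τ + t / 2) * (starRingEnd ℂ) (f (τ - t / 2)) *
    Complex.exp (-(2 * Real.pi * η * t : ℝ) * Complex.I)

/-- The short-time Fourier transform of `x` with window `g`. -/
noncomputable def STFT (x g : ℝ → ℂ) (t ξ : ℝ) : ℂ :=
  ∫ s : ℝ, x s * g (s - t) * Complex.exp (-(2 * Real.pi * ξ * s : ℝ) * Complex.I)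

/-- The linear chirp `x₀(s) = exp(2πi(a s²/2 + b s))`. -/
noncomputable def chirp (a b : ℝ) (s : ℝ) : ℂ :=
  Complex.exp (((2 * Real.pi * (a * s ^ 2 / 2 + b * s) : ℝ) : ℂ) * Complex.I)

/-- The map `(t, τ) ↦ (τ + t / 2, τ - t / 2)` preserves Lebesgue measure on the plane. -/
lemma measurePreserving_add_half_sub_half :
    MeasurePreserving (fun p : ℝ × ℝ => (p.2 + p.1 / 2, p.2 - p.1 / 2))
      (volume.prod volume) (volume.prod volume) := by
  have shift : MeasurePreserving (fun p : ℝ × ℝ => (p.1, p.2 + p.1 / 2))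
      (volume.prod volume) (volume.prod volume) :=
    (MeasurePreserving.id volume).skew_product (g := fun t τ => τ + t / 2) (by fun_prop)
      (Filter.Eventually.of_forall fun t => map_add_right_eq_self volume (t / 2))
  have reflect : MeasurePreserving (fun p : ℝ × ℝ => (p.1, p.1 - p.2))
      (volume.prod volume) (volume.prod volume) :=
    (MeasurePreserving.id volume).skew_product (g := fun u t => u - t) (by fun_prop)
      (Filter.Eventually.of_forall fun u => Measure.map_sub_left_eq_self volume u)
  convert reflect.comp (Measure.measurePreserving_swap.comp shift) using 1
  ext p
  · rfl
  · simp only [Function.comp_apply, Prod.swap_prod_mk]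
    ring

lemma integrable_integral_add_half_sub_half {K : ℝ × ℝ → ℂ}
    (hK : Integrable K (volume.prod volume)) :
    Integrable (fun τ : ℝ => ∫ t : ℝ, K (τ + t / 2, τ - t / 2)) :=
  (measurePreserving_add_half_sub_half.integrable_comp_of_integrable hK).integral_prod_right

lemma integral_integral_add_half_sub_half {K : ℝ × ℝ → ℂ}
    (hK : Integrable K (volume.prod volume)) :
    ∫ τ : ℝ, ∫ t : ℝ, K (τ + t / 2, τ - t / 2) = ∫ p, K p ∂(volume.prod volume) := by
  have mp := measurePreserving_add_half_sub_half
  have comp_eq : ∫ p, K p ∂(volume.prod volume)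
      = ∫ p : ℝ × ℝ, K (p.2 + p.1 / 2, p.2 - p.1 / 2) ∂(volume.prod volume) := by
    conv_lhs => rw [← mp.map_eq]
    exact integral_map mp.measurable.aemeasurable
      (by rw [mp.map_eq]; exact hK.aestronglyMeasurable)
  rw [comp_eq]
  exact (integral_prod_symm _ (mp.integrable_comp_of_integrable hK)).symm

/-- The phase of the linear chirp, demodulated by `ξ` and centred at `t₀`. -/
noncomputable def chirpPhase (a b t₀ ξ u : ℝ) : ℝ :=
  2 * Real.pi * (a * (u + t₀) ^ 2 / 2 + (b - ξ) * (u + t₀))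

lemma hasDerivAt_chirpPhase (a b t₀ ξ u : ℝ) :
    HasDerivAt (chirpPhase a b t₀ ξ) (2 * Real.pi * (a * (u + t₀) + b - ξ)) u := by
  have hid : HasDerivAt (fun u : ℝ => u + t₀) 1 u := (hasDerivAt_id u).add_const t₀
  refine (((((hid.pow 2).const_mul a).div_const 2).add
    (hid.const_mul (b - ξ))).const_mul (2 * Real.pi)).congr_deriv ?_
  push_cast
  ring

lemma continuous_chirpPhase (a b t₀ ξ : ℝ) : Continuous (chirpPhase a b t₀ ξ) := by
  unfold chirpPhase
  fun_prop

lemma chirpPhase_add_half_sub_sub_half (a b t₀ ξ τ t : ℝ) :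
    chirpPhase a b t₀ ξ (τ + t / 2) - chirpPhase a b t₀ ξ (τ - t / 2)
      = 2 * Real.pi * (a * (τ + t₀) + b - ξ) * t := by
  unfold chirpPhase
  ring

lemma STFT_chirp_eq (g : ℝ → ℂ) (a b t₀ ξ : ℝ) :
    STFT (chirp a b) g t₀ ξ
      = ∫ u : ℝ, g u * Complex.exp ((chirpPhase a b t₀ ξ u : ℂ) * Complex.I) := by
  rw [STFT, ← integral_add_right_eq_self _ t₀]
  congr 1 with u
  rw [add_sub_cancel_right, chirp, mul_comm _ (g u), mul_assoc, ← Complex.exp_add]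
  congr 2
  unfold chirpPhase
  push_cast
  ring

lemma conj_exp_ofReal_mul_I (x : ℝ) :
    (starRingEnd ℂ) (Complex.exp ((x : ℂ) * Complex.I))
      = Complex.exp (-(x : ℂ) * Complex.I) := by
  rw [← Complex.exp_conj]
  simp

lemma WVD_eq_integral_chirp (h : ℝ → ℝ) (a b t₀ ξ τ : ℝ) :
    WVD (fun t => (h t : ℂ)) τ (a * (τ + t₀) + b - ξ)
      = ∫ t : ℝ, (starRingEnd ℂ) ((h (τ + t / 2) : ℂ)
            * Complex.exp ((chirpPhase a b t₀ ξ (τ + t / 2) : ℂ) * Complex.I))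
          * ((h (τ - t / 2) : ℂ)
            * Complex.exp ((chirpPhase a b t₀ ξ (τ - t / 2) : ℂ) * Complex.I)) := by
  unfold WVD
  congr 1 with t
  have hexp : Complex.exp (-((2 * Real.pi * (a * (τ + t₀) + b - ξ) * t : ℝ) : ℂ) * Complex.I)
      = Complex.exp (-(chirpPhase a b t₀ ξ (τ + t / 2) : ℂ) * Complex.I)
        * Complex.exp ((chirpPhase a b t₀ ξ (τ - t / 2) : ℂ) * Complex.I) := by
    rw [← Complex.exp_add, ← chirpPhase_add_half_sub_sub_half]
    congr 1
    push_cast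
    ring
  rw [hexp, map_mul, conj_exp_ofReal_mul_I, Complex.conj_ofReal, Complex.conj_ofReal]
  ring

lemma integrable_mul_exp_chirpPhase {g : ℝ → ℂ} (hg : Integrable g) (a b t₀ ξ : ℝ) :
    Integrable (fun u => g u * Complex.exp ((chirpPhase a b t₀ ξ u : ℂ) * Complex.I)) := by
  refine hg.mul_bdd (c := 1) ?_ (Filter.Eventually.of_forall fun u => ?_)
  · have := continuous_chirpPhase a b t₀ ξ
    exact Continuous.aestronglyMeasurable (by fun_prop)
  · exact (Complex.norm_exp_ofReal_mul_I _).le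

lemma SchwartzMap.integrable_ofReal (h : SchwartzMap ℝ ℝ) :
    Integrable (fun u => (h u : ℂ)) :=
  h.integrable.ofReal

lemma SchwartzMap.integrable_id_mul_ofReal (h : SchwartzMap ℝ ℝ) :
    Integrable (fun u : ℝ => (u : ℂ) * (h u : ℂ)) := by
  refine (h.integrable_pow_mul volume 1).mono' ?_ (Filter.Eventually.of_forall fun u => ?_)
  · have := h.continuous
    exact Continuous.aestronglyMeasurable (by fun_prop)
  · simp

lemma SchwartzMap.integrable_ofReal_of_hasDerivAt (h : SchwartzMap ℝ ℝ) {h' : ℝ → ℝ}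
    (hh' : ∀ t : ℝ, HasDerivAt (fun s : ℝ => h s) (h' t) t) :
    Integrable (fun u => (h' u : ℂ)) := by
  have : h' = SchwartzMap.derivCLM ℝ ℝ h := by
    ext t
    exact (hh' t).deriv.symm
  rw [this]
  exact (SchwartzMap.derivCLM ℝ ℝ h).integrable_ofReal

/-- Integration by parts: the transform with window `h'` in terms of the zeroth and first moments
of the demodulated signal seen through the window `h`. -/
lemma STFT_chirp_deriv (h : SchwartzMap ℝ ℝ) {h' : ℝ → ℝ}
    (hh' : ∀ t : ℝ, HasDerivAt (fun s : ℝ => h s) (h' t) t) (a b t₀ ξ : ℝ) :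
    STFT (chirp a b) (fun t => (h' t : ℂ)) t₀ ξ
      = -(2 * Real.pi * Complex.I) *
        (a * STFT (chirp a b) (fun t : ℝ => (t : ℂ) * (h t : ℂ)) t₀ ξ
          + (a * t₀ + b - ξ) * STFT (chirp a b) (fun t => (h t : ℂ)) t₀ ξ) := by
  simp only [STFT_chirp_eq]
  have hF := integrable_mul_exp_chirpPhase h.integrable_ofReal a b t₀ ξ
  have hG := integrable_mul_exp_chirpPhase h.integrable_id_mul_ofReal a b t₀ ξ
  have hF' := integrable_mul_exp_chirpPhase (h.integrable_ofReal_of_hasDerivAt hh') a b t₀ ξ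
  have hM := by
    simpa only [Pi.add_apply] using ((hG.const_mul (a : ℂ)).add
      (hF.const_mul (a * t₀ + b - ξ : ℂ))).const_mul (2 * Real.pi * Complex.I)
  have hderiv : ∀ u : ℝ, HasDerivAt
      (fun u => (h u : ℂ) * Complex.exp ((chirpPhase a b t₀ ξ u : ℂ) * Complex.I))
      ((h' u : ℂ) * Complex.exp ((chirpPhase a b t₀ ξ u : ℂ) * Complex.I)
        + 2 * Real.pi * Complex.I *
          (a * ((u : ℂ) * (h u : ℂ) * Complex.exp ((chirpPhase a b t₀ ξ u : ℂ) * Complex.I))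
            + (a * t₀ + b - ξ)
              * ((h u : ℂ) * Complex.exp ((chirpPhase a b t₀ ξ u : ℂ) * Complex.I)))) u := by
    intro u
    refine ((hh' u).ofReal_comp.mul ((hasDerivAt_chirpPhase a b t₀ ξ u).ofReal_comp.mul_const
      Complex.I).cexp).congr_deriv ?_
    push_cast
    ring
  have hzero := integral_eq_zero_of_hasDerivAt_of_integrable hderiv (hF'.add hM) hF
  rw [integral_add hF' hM, integral_const_mul, integral_add (hG.const_mul _) (hF.const_mul _),
    integral_const_mul, integral_const_mul] at hzero
  linear_combination hzero

lemma integrable_conj_mul_prod {f g : ℝ → ℂ} (hf : Integrable f) (hg : Integrable g) :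
    Integrable (fun p : ℝ × ℝ => (starRingEnd ℂ) (f p.1) * g p.2) (volume.prod volume) :=
  Integrable.mul_prod (Complex.conjLIE.integrable_comp_iff.mpr hf) hg

lemma integral_conj_mul_prod (f g : ℝ → ℂ) :
    ∫ p : ℝ × ℝ, (starRingEnd ℂ) (f p.1) * g p.2 ∂(volume.prod volume)
      = (starRingEnd ℂ) (∫ u, f u) * ∫ u, g u := by
  rw [integral_prod_mul (fun u => (starRingEnd ℂ) (f u)) g, integral_conj]

section Moments

variable (h : SchwartzMap ℝ ℝ) (a b t₀ ξ : ℝ)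

lemma integrable_WVD_chirp :
    Integrable (fun τ : ℝ => WVD (fun t => (h t : ℂ)) τ (a * (τ + t₀) + b - ξ)) := by
  have hF := integrable_mul_exp_chirpPhase h.integrable_ofReal a b t₀ ξ
  simp only [WVD_eq_integral_chirp]
  exact integrable_integral_add_half_sub_half (integrable_conj_mul_prod hF hF)

lemma integral_WVD_chirp :
    ∫ τ : ℝ, WVD (fun t => (h t : ℂ)) τ (a * (τ + t₀) + b - ξ)
      = (starRingEnd ℂ) (STFT (chirp a b) (fun t => (h t : ℂ)) t₀ ξ)
        * STFT (chirp a b) (fun t => (h t : ℂ)) t₀ ξ := by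
  have hF := integrable_mul_exp_chirpPhase h.integrable_ofReal a b t₀ ξ
  simp only [WVD_eq_integral_chirp, STFT_chirp_eq]
  rw [← integral_conj_mul_prod]
  exact integral_integral_add_half_sub_half (integrable_conj_mul_prod hF hF)

/-- The first moment of the Wigner–Ville distribution along the chirp line, using
`τ = ((τ + t / 2) + (τ - t / 2)) / 2`. -/
lemma mul_WVD_eq_integral_chirp (τ : ℝ) :
    (τ : ℂ) * WVD (fun t => (h t : ℂ)) τ (a * (τ + t₀) + b - ξ)
      = ∫ t : ℝ, (fun p : ℝ × ℝ => (1 / 2 : ℂ) *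
        ((starRingEnd ℂ) ((p.1 : ℂ) * (h p.1 : ℂ)
              * Complex.exp ((chirpPhase a b t₀ ξ p.1 : ℂ) * Complex.I))
            * ((h p.2 : ℂ) * Complex.exp ((chirpPhase a b t₀ ξ p.2 : ℂ) * Complex.I))
          + (starRingEnd ℂ) ((h p.1 : ℂ)
              * Complex.exp ((chirpPhase a b t₀ ξ p.1 : ℂ) * Complex.I))
            * ((p.2 : ℂ) * (h p.2 : ℂ)
              * Complex.exp ((chirpPhase a b t₀ ξ p.2 : ℂ) * Complex.I))))
        (τ + t / 2, τ - t / 2) := by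
  rw [WVD_eq_integral_chirp, ← integral_const_mul]
  congr 1 with t
  simp only [map_mul, Complex.conj_ofReal]
  push_cast
  ring

lemma integrable_mul_WVD_chirp :
    Integrable (fun τ : ℝ =>
      (τ : ℂ) * WVD (fun t => (h t : ℂ)) τ (a * (τ + t₀) + b - ξ)) := by
  have hF := integrable_mul_exp_chirpPhase h.integrable_ofReal a b t₀ ξ
  have hG := integrable_mul_exp_chirpPhase h.integrable_id_mul_ofReal a b t₀ ξ
  simp only [mul_WVD_eq_integral_chirp h a b t₀ ξ]
  exact integrable_integral_add_half_sub_half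
    (((integrable_conj_mul_prod hG hF).add (integrable_conj_mul_prod hF hG)).const_mul _)

lemma integral_mul_WVD_chirp :
    ∫ τ : ℝ, (τ : ℂ) * WVD (fun t => (h t : ℂ)) τ (a * (τ + t₀) + b - ξ)
      = (1 / 2 : ℂ) *
        ((starRingEnd ℂ) (STFT (chirp a b) (fun t : ℝ => (t : ℂ) * (h t : ℂ)) t₀ ξ)
            * STFT (chirp a b) (fun t => (h t : ℂ)) t₀ ξ
          + (starRingEnd ℂ) (STFT (chirp a b) (fun t => (h t : ℂ)) t₀ ξ)
            * STFT (chirp a b) (fun t : ℝ => (t : ℂ) * (h t : ℂ)) t₀ ξ) := by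
  have hF := integrable_mul_exp_chirpPhase h.integrable_ofReal a b t₀ ξ
  have hG := integrable_mul_exp_chirpPhase h.integrable_id_mul_ofReal a b t₀ ξ
  have hGF := integrable_conj_mul_prod hG hF
  have hFG := integrable_conj_mul_prod hF hG
  simp only [mul_WVD_eq_integral_chirp h a b t₀ ξ, STFT_chirp_eq]
  rw [← integral_conj_mul_prod, ← integral_conj_mul_prod, ← integral_add hGF hFG,
    ← integral_const_mul]
  exact integral_integral_add_half_sub_half ((hGF.add hFG).const_mul _)

lemma integral_frequency_mul_WVD_chirp :
    ∫ τ : ℝ, ((a * (τ + t₀) + b - ξ : ℝ) : ℂ)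
        * WVD (fun t => (h t : ℂ)) τ (a * (τ + t₀) + b - ξ)
      = a * (∫ τ : ℝ, (τ : ℂ) * WVD (fun t => (h t : ℂ)) τ (a * (τ + t₀) + b - ξ))
        + ((a * t₀ + b - ξ : ℝ) : ℂ)
          * ∫ τ : ℝ, WVD (fun t => (h t : ℂ)) τ (a * (τ + t₀) + b - ξ) := by
  rw [← integral_const_mul, ← integral_const_mul, ← integral_add
    ((integrable_mul_WVD_chirp h a b t₀ ξ).const_mul _)
    ((integrable_WVD_chirp h a b t₀ ξ).const_mul _)]
  congr 1 with τ
  push_cast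
  ring

end Moments

lemma neg_im_STFT_chirp_deriv_mul_conj (h : SchwartzMap ℝ ℝ) {h' : ℝ → ℝ}
    (hh' : ∀ t : ℝ, HasDerivAt (fun s : ℝ => h s) (h' t) t) (a b t₀ ξ : ℝ) :
    ((-(STFT (chirp a b) (fun t => (h' t : ℂ)) t₀ ξ
        * (starRingEnd ℂ) (STFT (chirp a b) (fun t => (h t : ℂ)) t₀ ξ)).im : ℝ) : ℂ)
      = 2 * (Real.pi : ℂ) * ∫ τ : ℝ, ((a * (τ + t₀) + b - ξ : ℝ) : ℂ)
          * WVD (fun t => (h t : ℂ)) τ (a * (τ + t₀) + b - ξ) := by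
  rw [integral_frequency_mul_WVD_chirp, integral_mul_WVD_chirp, integral_WVD_chirp,
    STFT_chirp_deriv h hh']
  apply Complex.ext
  · simp
    ring
  · simp
    ring

lemma ofReal_neg_im_div (z w : ℂ) :
    ((-(z / w).im : ℝ) : ℂ)
      = ((-(z * (starRingEnd ℂ) w).im : ℝ) : ℂ) / ((starRingEnd ℂ) w * w) := by
  rw [← Complex.normSq_eq_conj_mul_self, ← Complex.ofReal_div, div_eq_mul_inv z,
    Complex.inv_def, ← mul_assoc, Complex.im_mul_ofReal, neg_div, div_eq_mul_inv]

theorem stmt15 (h : SchwartzMap ℝ ℝ) (h' : ℝ → ℝ)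
    (hh' : ∀ t : ℝ, HasDerivAt (fun s : ℝ => h s) (h' t) t)
    (a b t₀ ξ : ℝ) :
    (((-(STFT (chirp a b) (fun t => (h' t : ℂ)) t₀ ξ
        * (starRingEnd ℂ) (STFT (chirp a b) (fun t => (h t : ℂ)) t₀ ξ)).im : ℝ) : ℂ)
      = 2 * (Real.pi : ℂ) * ∫ τ : ℝ, ((a * (τ + t₀) + b - ξ : ℝ) : ℂ)
          * WVD (fun t => (h t : ℂ)) τ (a * (τ + t₀) + b - ξ))
    ∧ (STFT (chirp a b) (fun t => (h t : ℂ)) t₀ ξ ≠ 0 →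
        ((-(STFT (chirp a b) (fun t => (h' t : ℂ)) t₀ ξ
            / STFT (chirp a b) (fun t => (h t : ℂ)) t₀ ξ).im : ℝ) : ℂ)
          = 2 * (Real.pi : ℂ) * (((a * t₀ + b - ξ : ℝ) : ℂ)
              + (a : ℂ) * (∫ τ : ℝ, (τ : ℂ) * WVD (fun t => (h t : ℂ)) τ (a * (τ + t₀) + b - ξ))
                / (∫ τ : ℝ, WVD (fun t => (h t : ℂ)) τ (a * (τ + t₀) + b - ξ)))) := by
  have hmain := neg_im_STFT_chirp_deriv_mul_conj h hh' a b t₀ ξ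
  refine ⟨hmain, fun hV => ?_⟩
  have hconj : (starRingEnd ℂ) (STFT (chirp a b) (fun t => (h t : ℂ)) t₀ ξ) ≠ 0 :=
    (map_ne_zero _).mpr hV
  rw [ofReal_neg_im_div, hmain, integral_frequency_mul_WVD_chirp, integral_WVD_chirp]
  field_simp
  ring
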